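/- Let Z be an n-dimensional Gaussian random vector with nondegenerate covariance matrix, let S₊ and S₋ be disjoint subsets of {1,…,n}, and let (a_u)_{u∈S₊}, (b_u)_{u∈S₋} be real thresholds such that the event E = {Z_u > a_u for all u ∈ S₊} ∩ {Z_u < b_u for all u ∈ S₋} has positive probability. Then for every vector l ∈ ℝⁿ, Var( l·Z | E ) ≤ Var( l·Z ). -/

import Mathlib

open MeasureTheory ProbabilityTheory Set

noncomputable section

/-- `f` is a centered Gaussian family with covariance `K`: every finite linear combination
of the `f i` is a centered Gaussian variable whose variance is the corresponding quadratic
form of `K`. -/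
def IsGaussFam {Ω ι : Type*} [MeasurableSpace Ω] (P : Measure Ω)
    (f : ι → Ω → ℝ) (K : ι → ι → ℝ) : Prop :=
  (∀ i, Measurable (f i)) ∧
  ∀ l : ι →₀ ℝ,
    P.map (fun ω => ∑ i ∈ l.support, l i * f i ω) =
      gaussianReal 0 (∑ i ∈ l.support, ∑ j ∈ l.support, l i * l j * K i j).toNNReal

open scoped ENNReal

theorem bm_compact (K L C : Set ℝ) (hK : IsCompact K) (hL : IsCompact L) (hKn : K.Nonempty)
    (hLn : L.Nonempty) (h : ∀ x ∈ K, ∀ y ∈ L, (x + y) / 2 ∈ C) :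
    volume K + volume L ≤ 2 * volume C := by
  obtain ⟨p, hp, hp'⟩ := hK.exists_isGreatest hKn
  obtain ⟨q, hq, hq'⟩ := hL.exists_isLeast hLn
  have hC : volume ((fun z => z * (1/2 : ℝ)) ⁻¹' C) = 2 * volume C := by
    rw [Real.volume_preimage_mul_right (by norm_num)]
    norm_num
  rw [← hC]
  set D := (fun z => z * (1/2 : ℝ)) ⁻¹' C with hD
  rw [← measure_inter_add_sdiff D (measurableSet_Iic (a := p + q))]
  have h1 : volume K ≤ volume (D ∩ Iic (p+q)) := by
    rw [← measure_preimage_add_right volume q (D ∩ Iic (p+q))]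
    apply measure_mono
    intro x hx
    refine ⟨?_, ?_⟩
    · simp only [hD, mem_preimage]
      have := h x hx q hq
      rwa [div_eq_mul_one_div] at this
    · simpa using hp' hx
  have h2 : volume L ≤ volume (D \ Iic (p+q)) := by
    rw [← measure_preimage_add volume p (D \ Iic (p+q))]
    have : volume L ≤ volume (L \ {q}) := by
      rw [measure_sdiff_null (by simp)]
    refine this.trans (measure_mono ?_)
    rintro x ⟨hx, hxq⟩
    refine ⟨?_, ?_⟩
    · simp only [hD, mem_preimage]
      have := h p hp x hx
      rwa [div_eq_mul_one_div] at this
    · have := hq' hx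
      simpa using lt_of_le_of_ne this (Ne.symm hxq)
  exact add_le_add h1 h2

theorem bm_one (A B C : Set ℝ) (hA : MeasurableSet A) (hB : MeasurableSet B) (hAn : A.Nonempty)
    (hBn : B.Nonempty) (h : ∀ x ∈ A, ∀ y ∈ B, (x + y) / 2 ∈ C) :
    volume A + volume B ≤ 2 * volume C := by
  obtain ⟨p, hp⟩ := hAn
  obtain ⟨q, hq⟩ := hBn
  rw [hA.measure_eq_iSup_isCompact, hB.measure_eq_iSup_isCompact]
  simp only [iSup_and']
  refine ENNReal.biSup_add_biSup_le' ⟨∅, by simp⟩ ⟨∅, by simp⟩ ?_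
  rintro K ⟨hKA, hK⟩ L ⟨hLB, hL⟩
  calc volume K + volume L ≤ volume (insert p K) + volume (insert q L) :=
        add_le_add (measure_mono (subset_insert _ _)) (measure_mono (subset_insert _ _))
    _ ≤ 2 * volume C := by
        apply bm_compact _ _ _ (hK.insert p) (hL.insert q) (insert_nonempty _ _)
          (insert_nonempty _ _)
        intro x hx y hy
        exact h x (insert_subset hp hKA hx) y (insert_subset hq hLB hy)

theorem pl_core (f g h : ℝ → ℝ) (hf : Measurable f) (hg : Measurable g) (hh : Measurable h)
    (f0 : ∀ x, 0 ≤ f x) (g0 : ∀ x, 0 ≤ g x) (h0 : ∀ x, 0 ≤ h x)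
    (f1 : ∀ x, f x ≤ 1) (g1 : ∀ x, g x ≤ 1)
    (fs : ∀ t < 1, ∃ x, t < f x) (gs : ∀ t < 1, ∃ x, t < g x)
    (H : ∀ x y, f x * g y ≤ h ((x + y) / 2) ^ 2) :
    (∫⁻ x, ENNReal.ofReal (f x)) + (∫⁻ x, ENNReal.ofReal (g x)) ≤
      2 * ∫⁻ x, ENNReal.ofReal (h x) := by
  rw [lintegral_eq_lintegral_meas_lt _ (.of_forall f0) hf.aemeasurable,
    lintegral_eq_lintegral_meas_lt _ (.of_forall g0) hg.aemeasurable,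
    lintegral_eq_lintegral_meas_lt _ (.of_forall h0) hh.aemeasurable]
  have hm : ∀ f : ℝ → ℝ, Measurable (fun t : ℝ => volume {a | t < f a}) := by
    intro f
    apply Antitone.measurable
    intro s t hst
    exact measure_mono fun x hx => lt_of_le_of_lt hst hx
  rw [← lintegral_add_left (hm f), ← lintegral_const_mul _ (hm h)]
  refine setLIntegral_mono ((hm h).const_mul _) ?_
  intro t ht
  rw [mem_Ioi] at ht
  by_cases h1 : t < 1
  · apply bm_one _ _ _ (measurableSet_lt measurable_const hf)
      (measurableSet_lt measurable_const hg) (fs t h1) (gs t h1)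
    intro x hx y hy
    simp only [mem_ofPred_eq] at *
    have := H x y
    by_contra hc
    push Not at hc
    have h3 := h0 ((x + y) / 2)
    nlinarith
  · have e1 : {a | t < f a} = ∅ := by
      ext x; simp; linarith [f1 x]
    have e2 : {a | t < g a} = ∅ := by
      ext x; simp; linarith [g1 x]
    simp [e1, e2]

theorem ennreal_amgm (F G H : ℝ≥0∞) (h : F + G ≤ 2 * H) : F * G ≤ H ^ 2 := by
  by_cases hH : H = ⊤
  · simp [hH]
  have hF : F ≠ ⊤ := by
    rintro rfl
    simp [ENNReal.mul_eq_top, hH] at h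
  have hG : G ≠ ⊤ := by
    rintro rfl
    simp [ENNReal.mul_eq_top, hH] at h
  lift F to NNReal using hF
  lift G to NNReal using hG
  lift H to NNReal using hH
  norm_cast at *
  have h' : (F : ℝ) + G ≤ 2 * H := by exact_mod_cast h
  have : (F : ℝ) * G ≤ H ^ 2 := by nlinarith [sq_nonneg ((F : ℝ) - G), F.2, G.2, H.2, F.coe_nonneg, G.coe_nonneg]
  exact_mod_cast this

theorem sup_norm_aux (f : ℝ → ℝ≥0∞) (a : NNReal) (ha : (a : ℝ≥0∞) = ⨆ x, f x)
    (fa : ∀ x, f x ≤ a) (ha0 : a ≠ 0) (t : ℝ) (ht : t < 1) : ∃ x, t < (f x / a).toReal := by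
  by_contra hc
  push Not at hc
  have ha0' : (a : ℝ≥0∞) ≠ 0 := by simpa using ha0
  have h1 : ∀ x, f x ≤ ENNReal.ofReal t * a := by
    intro x
    have hT : f x / a ≠ ⊤ :=
      ENNReal.div_ne_top (ne_top_of_le_ne_top ENNReal.coe_ne_top (fa x)) ha0'
    have := (ENNReal.le_ofReal_iff_toReal_le hT
      (ENNReal.toReal_nonneg.trans (hc x))).2 (hc x)
    exact (ENNReal.div_le_iff_le_mul (Or.inl ha0') (Or.inl ENNReal.coe_ne_top)).1 this
  have h2 : (a : ℝ≥0∞) ≤ ENNReal.ofReal t * a := ha.le.trans (iSup_le h1)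
  have h3 : ENNReal.ofReal t * a < 1 * a :=
    ENNReal.mul_lt_mul_left ha0' ENNReal.coe_ne_top (by simpa using ht)
  rw [one_mul] at h3
  exact absurd h2 (not_le.2 h3)

theorem pl_bdd (f g h : ℝ → ℝ≥0∞) (hf : Measurable f) (hg : Measurable g) (hh : Measurable h)
    (N : ℝ≥0∞) (hN : N ≠ ⊤) (fN : ∀ x, f x ≤ N) (gN : ∀ x, g x ≤ N)
    (H : ∀ x y, f x * g y ≤ h ((x + y) / 2) ^ 2) :
    (∫⁻ x, f x) * (∫⁻ x, g x) ≤ (∫⁻ x, h x) ^ 2 := by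
  set a := ⨆ x, f x with ha
  set b := ⨆ x, g x with hb
  have haT : a ≠ ⊤ := ne_top_of_le_ne_top hN (iSup_le fN)
  have hbT : b ≠ ⊤ := ne_top_of_le_ne_top hN (iSup_le gN)
  have fa : ∀ x, f x ≤ a := le_iSup f
  have gb : ∀ x, g x ≤ b := le_iSup g
  by_cases ha0 : a = 0
  · have : ∀ x, f x = 0 := fun x => by simpa [ha0] using fa x
    simp [this]
  by_cases hb0 : b = 0
  · have : ∀ x, g x = 0 := fun x => by simpa [hb0] using gb x
    simp [this]
  clear_value a b
  lift a to NNReal using haT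
  lift b to NNReal using hbT
  have ha0' : a ≠ 0 := by simpa using ha0
  have hb0' : b ≠ 0 := by simpa using hb0
  set s := NNReal.sqrt (a * b) with hs
  have hss : s ^ 2 = a * b := by simp [hs]
  have hs0 : s ≠ 0 := by
    rintro h; rw [h] at hss; simp at hss; tauto
  have key := pl_core (fun x => (f x / a).toReal) (fun x => (g x / b).toReal)
    (fun x => (min (h x / s) 1).toReal) (by fun_prop) (by fun_prop) (by fun_prop)
    (fun _ => ENNReal.toReal_nonneg) (fun _ => ENNReal.toReal_nonneg)
    (fun _ => ENNReal.toReal_nonneg) ?_ ?_ ?_ ?_ ?_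
  · have q1 : ∀ x, ENNReal.ofReal (f x / a).toReal = f x / a := fun x =>
      ENNReal.ofReal_toReal (ENNReal.div_ne_top (ne_top_of_le_ne_top ENNReal.coe_ne_top (fa x)) ha0)
    have q2 : ∀ x, ENNReal.ofReal (g x / b).toReal = g x / b := fun x =>
      ENNReal.ofReal_toReal (ENNReal.div_ne_top (ne_top_of_le_ne_top ENNReal.coe_ne_top (gb x)) hb0)
    have q3 : ∀ x, ENNReal.ofReal (min (h x / s) 1).toReal ≤ h x / s := fun x =>
      ENNReal.ofReal_toReal_le.trans (min_le_left _ _)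
    simp only [q1, q2] at key
    have key2 := key.trans (mul_le_mul_right (lintegral_mono q3) 2)
    have k3 := ennreal_amgm _ _ _ key2
    simp only [div_eq_mul_inv] at k3
    rw [lintegral_mul_const _ hf, lintegral_mul_const _ hg, lintegral_mul_const _ hh] at k3
    have k4 := mul_le_mul_right k3 ((s : ℝ≥0∞) ^ 2)
    have ea : (a : ℝ≥0∞) * (a : ℝ≥0∞)⁻¹ = 1 := ENNReal.mul_inv_cancel ha0 ENNReal.coe_ne_top
    have eb : (b : ℝ≥0∞) * (b : ℝ≥0∞)⁻¹ = 1 := ENNReal.mul_inv_cancel hb0 ENNReal.coe_ne_top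
    have es : (s : ℝ≥0∞) * (s : ℝ≥0∞)⁻¹ = 1 :=
      ENNReal.mul_inv_cancel (by simpa using hs0) ENNReal.coe_ne_top
    have hss' : (s : ℝ≥0∞) ^ 2 = a * b := by exact_mod_cast hss
    calc (∫⁻ x, f x) * (∫⁻ x, g x)
        = (a * (a : ℝ≥0∞)⁻¹) * (b * (b : ℝ≥0∞)⁻¹) * ((∫⁻ x, f x) * (∫⁻ x, g x)) := by
          rw [ea, eb]; simp
      _ = s ^ 2 * ((∫⁻ x, f x) * (a : ℝ≥0∞)⁻¹ * ((∫⁻ x, g x) * (b : ℝ≥0∞)⁻¹)) := by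
          rw [hss']; ring
      _ ≤ _ := k4
      _ = (s * (s : ℝ≥0∞)⁻¹) ^ 2 * (∫⁻ x, h x) ^ 2 := by ring
      _ = _ := by rw [es]; simp
  · intro x
    exact ENNReal.toReal_le_of_le_ofReal zero_le_one (by
      simpa using ENNReal.div_le_of_le_mul (by simpa using fa x))
  · intro x
    exact ENNReal.toReal_le_of_le_ofReal zero_le_one (by
      simpa using ENNReal.div_le_of_le_mul (by simpa using gb x))
  · intro t ht
    exact sup_norm_aux f a ha fa ha0' t ht
  · intro t ht
    exact sup_norm_aux g b hb gb hb0' t ht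
  · intro x y
    rw [← ENNReal.toReal_mul, ← ENNReal.toReal_pow]
    have hfa : f x / a ≤ 1 := ENNReal.div_le_of_le_mul (by simpa using fa x)
    have hgb : g y / b ≤ 1 := ENNReal.div_le_of_le_mul (by simpa using gb y)
    apply ENNReal.toReal_mono
    · exact ENNReal.pow_ne_top (ne_top_of_le_ne_top ENNReal.one_ne_top (min_le_right _ _))
    · rcases min_cases (h ((x + y) / 2) / s) 1 with ⟨e, _⟩ | ⟨e, _⟩
      · rw [e]
        have hss' : (s : ℝ≥0∞) ^ 2 = a * b := by exact_mod_cast hss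
        calc f x / a * (g y / b) = (f x * g y) * ((a : ℝ≥0∞) * b)⁻¹ := by
              rw [ENNReal.mul_inv (Or.inl ha0) (Or.inl ENNReal.coe_ne_top)]
              simp only [div_eq_mul_inv]; ring
          _ ≤ h ((x + y) / 2) ^ 2 * ((a : ℝ≥0∞) * b)⁻¹ := by gcongr; exact H x y
          _ = _ := by rw [← hss', div_eq_mul_inv (h _), mul_pow, ENNReal.inv_pow]
      · rw [e]; simpa using mul_le_mul' hfa hgb

theorem pl_one (f g h : ℝ → ℝ≥0∞) (hf : Measurable f) (hg : Measurable g) (hh : Measurable h)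
    (H : ∀ x y, f x * g y ≤ h ((x + y) / 2) ^ 2) :
    (∫⁻ x, f x) * (∫⁻ x, g x) ≤ (∫⁻ x, h x) ^ 2 := by
  have hk : ∀ f : ℝ → ℝ≥0∞, Measurable f →
      ∫⁻ x, f x = ⨆ N : ℕ, ∫⁻ x, min (f x) N := by
    intro f hf
    rw [← lintegral_iSup (fun N => by fun_prop)]
    · congr 1 with x
      rw [← inf_iSup_eq, ENNReal.iSup_natCast]
      simp
    · intro i j hij x
      exact min_le_min le_rfl (by exact_mod_cast hij)
  rw [hk f hf, hk g hg, ENNReal.iSup_mul]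
  refine iSup_le fun N => ?_
  rw [ENNReal.mul_iSup]
  refine iSup_le fun M => ?_
  refine pl_bdd _ _ h (by fun_prop) (by fun_prop) hh (max N M) (by simp) (by simp) (by simp) ?_
  intro x y
  exact (mul_le_mul' (min_le_left _ _) (min_le_left _ _)).trans (H x y)

theorem pl_gauss_one (f g h : ℝ → ℝ≥0∞) (hf : Measurable f) (hg : Measurable g)
    (hh : Measurable h)
    (H : ∀ x y, f x * g y ≤ h ((x + y) / 2) ^ 2 * ENNReal.ofReal (Real.exp ((x - y) ^ 2 / 4))) :
    (∫⁻ x, f x ∂(gaussianReal 0 1)) * (∫⁻ x, g x ∂(gaussianReal 0 1)) ≤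
      (∫⁻ x, h x ∂(gaussianReal 0 1)) ^ 2 := by
  rw [gaussianReal_of_var_ne_zero 0 one_ne_zero]
  rw [lintegral_withDensity_eq_lintegral_mul _ (by fun_prop) hf,
    lintegral_withDensity_eq_lintegral_mul _ (by fun_prop) hg,
    lintegral_withDensity_eq_lintegral_mul _ (by fun_prop) hh]
  apply pl_one
  · exact (measurable_gaussianPDF 0 1).mul hf
  · exact (measurable_gaussianPDF 0 1).mul hg
  · exact (measurable_gaussianPDF 0 1).mul hh
  intro x y
  have e : gaussianPDF 0 1 x * gaussianPDF 0 1 y * ENNReal.ofReal (Real.exp ((x - y) ^ 2 / 4))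
      = gaussianPDF 0 1 ((x + y) / 2) ^ 2 := by
    simp only [gaussianPDF]
    rw [← ENNReal.ofReal_mul (gaussianPDFReal_nonneg _ _ _), ← ENNReal.ofReal_mul
      (mul_nonneg (gaussianPDFReal_nonneg _ _ _) (gaussianPDFReal_nonneg _ _ _)),
      ← ENNReal.ofReal_pow (gaussianPDFReal_nonneg _ _ _)]
    congr 1
    simp only [gaussianPDFReal]
    rw [mul_pow, ← Real.exp_nat_mul]
    have : ∀ c a b d : ℝ, c * Real.exp a * (c * Real.exp b) * Real.exp d
      = c ^ 2 * Real.exp (a + b + d) := by intro c a b d; rw [Real.exp_add, Real.exp_add]; ring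
    rw [this]
    congr 2
    push_cast
    ring
  simp only [Pi.mul_apply]
  calc gaussianPDF 0 1 x * f x * (gaussianPDF 0 1 y * g y)
      = gaussianPDF 0 1 x * gaussianPDF 0 1 y * (f x * g y) := by ring
    _ ≤ gaussianPDF 0 1 x * gaussianPDF 0 1 y *
        (h ((x + y) / 2) ^ 2 * ENNReal.ofReal (Real.exp ((x - y) ^ 2 / 4))) := by
        exact mul_le_mul_right (H x y) _
    _ = (gaussianPDF 0 1 x * gaussianPDF 0 1 y * ENNReal.ofReal (Real.exp ((x - y) ^ 2 / 4))) *
        h ((x + y) / 2) ^ 2 := by ring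
    _ = _ := by rw [e]; ring

theorem piFinSucc_symm (n : ℕ) (p : ℝ × (Fin n → ℝ)) :
    (MeasurableEquiv.piFinSuccAbove (fun _ : Fin (n + 1) => ℝ) 0).symm p =
      (Fin.cons p.1 p.2 : Fin (n + 1) → ℝ) := by
  simp [MeasurableEquiv.piFinSuccAbove, Fin.insertNthEquiv]

theorem one_add_sq_le_cosh (x : ℝ) : 1 + x ^ 2 / 2 ≤ Real.cosh x := by
  have h1 : Real.cosh x = 1 + 2 * Real.sinh (x / 2) ^ 2 := by
    have := Real.cosh_two_mul (x / 2)
    rw [Real.cosh_sq, mul_div_cancel₀ x two_ne_zero] at this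
    linarith
  have h2 : |x / 2| ≤ |Real.sinh (x / 2)| := by
    rw [Real.abs_sinh]
    exact Real.self_le_sinh_iff.2 (abs_nonneg _)
  have := sq_le_sq.2 h2
  nlinarith

theorem lintegral_pi_succ (n : ℕ) (f : (Fin (n + 1) → ℝ) → ℝ≥0∞) (hf : Measurable f) :
    ∫⁻ x, f x ∂(Measure.pi fun _ => gaussianReal 0 1) =
      ∫⁻ t, ∫⁻ y, f (Fin.cons t y) ∂(Measure.pi fun _ : Fin n => gaussianReal 0 1)
        ∂(gaussianReal 0 1) := by
  have hp := measurePreserving_piFinSuccAbove (fun _ : Fin (n + 1) => gaussianReal 0 1) 0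
  rw [← (hp.symm).lintegral_comp_emb (MeasurableEquiv.measurableEmbedding _), lintegral_prod]
  · simp only [piFinSucc_symm]
  · exact (hf.comp (MeasurableEquiv.measurable _)).aemeasurable

theorem pl_gauss : ∀ (n : ℕ) (f g h : (Fin n → ℝ) → ℝ≥0∞) (_ : Measurable f) (_ : Measurable g)
    (_ : Measurable h)
    (_ : ∀ x y, f x * g y ≤ h (fun i => (x i + y i) / 2) ^ 2 *
      ENNReal.ofReal (Real.exp (∑ i, (x i - y i) ^ 2 / 4))),
    (∫⁻ x, f x ∂(Measure.pi fun _ => gaussianReal 0 1)) *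
      (∫⁻ x, g x ∂(Measure.pi fun _ => gaussianReal 0 1)) ≤
      (∫⁻ x, h x ∂(Measure.pi fun _ => gaussianReal 0 1)) ^ 2
  | 0, f, g, h, hf, hg, hh, H => by
    have := H default default
    simp only [Measure.pi_of_empty _ default, lintegral_dirac]
    have e : (fun i => ((default : Fin 0 → ℝ) i + (default : Fin 0 → ℝ) i) / 2) = default :=
      Subsingleton.elim _ _
    rw [e] at this
    simpa using this
  | n + 1, f, g, h, hf, hg, hh, H => by
    have hc : Measurable (fun p : ℝ × (Fin n → ℝ) => (Fin.cons p.1 p.2 : Fin (n + 1) → ℝ)) := by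
      simp only [← piFinSucc_symm]
      exact (MeasurableEquiv.piFinSuccAbove (fun _ : Fin (n + 1) => ℝ) 0).symm.measurable
    have hm : ∀ f : (Fin (n + 1) → ℝ) → ℝ≥0∞, Measurable f → Measurable (fun t : ℝ =>
        ∫⁻ y, f (Fin.cons t y) ∂(Measure.pi fun _ : Fin n => gaussianReal 0 1)) := 
      fun f hf => (hf.comp hc).lintegral_prod_right'
    have hs : ∀ f : (Fin (n + 1) → ℝ) → ℝ≥0∞, Measurable f → ∀ t : ℝ, Measurable (fun y =>
        f (Fin.cons t y)) := fun f hf t => hf.comp (hc.comp measurable_prodMk_left)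
    rw [lintegral_pi_succ n f hf, lintegral_pi_succ n g hg, lintegral_pi_succ n h hh]
    apply pl_gauss_one _ _ _ (hm f hf) (hm g hg) (hm h hh)
    intro s t
    set c := ENNReal.ofReal (Real.exp ((s - t) ^ 2 / 8)) with hcd
    have hc2 : c ^ 2 = ENNReal.ofReal (Real.exp ((s - t) ^ 2 / 4)) := by
      rw [hcd, ← ENNReal.ofReal_pow (Real.exp_nonneg _), ← Real.exp_nat_mul]
      congr 2; push_cast; ring
    rw [← hc2, ← mul_pow, ← lintegral_mul_const _ (hs h hh _)]
    apply pl_gauss n _ _ _ (hs f hf s) (hs g hg t) ((hs h hh _).mul_const _)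
    intro x y
    have := H (Fin.cons s x) (Fin.cons t y)
    refine this.trans (le_of_eq ?_)
    rw [Fin.sum_univ_succ, Real.exp_add, ENNReal.ofReal_mul (Real.exp_nonneg _), mul_pow, hc2,
      ← mul_assoc]
    congr 4
    ext i
    refine Fin.cases ?_ (fun j => ?_) i <;> simp

theorem gauss_exp (n : ℕ) (C : Set (Fin n → ℝ)) (hC : MeasurableSet C)
    (hconv : ∀ x ∈ C, ∀ y ∈ C, (fun i => (x i + y i) / 2) ∈ C) (k : Fin n → ℝ) :
    (∫⁻ x in C, ENNReal.ofReal (Real.exp (∑ i, k i * x i))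
        ∂(Measure.pi fun _ => gaussianReal 0 1)) *
      (∫⁻ x in C, ENNReal.ofReal (Real.exp (- ∑ i, k i * x i))
        ∂(Measure.pi fun _ => gaussianReal 0 1)) ≤
    ENNReal.ofReal (Real.exp (∑ i, k i ^ 2)) *
      ((Measure.pi fun _ => gaussianReal 0 1) C) ^ 2 := by
  set c := ENNReal.ofReal (Real.exp ((∑ i, k i ^ 2) / 2)) with hcd
  have hc2 : c ^ 2 = ENNReal.ofReal (Real.exp (∑ i, k i ^ 2)) := by
    rw [hcd, ← ENNReal.ofReal_pow (Real.exp_nonneg _), ← Real.exp_nat_mul]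
    congr 2; push_cast; ring
  rw [← hc2, ← mul_pow, ← setLIntegral_const, ← lintegral_indicator hC, ← lintegral_indicator hC,
    ← lintegral_indicator hC]
  apply pl_gauss
  · exact Measurable.indicator (by fun_prop) hC
  · exact Measurable.indicator (by fun_prop) hC
  · exact Measurable.indicator (by fun_prop) hC
  intro x y
  by_cases hx : x ∈ C
  · by_cases hy : y ∈ C
    · rw [indicator_of_mem hx, indicator_of_mem hy, indicator_of_mem (hconv x hx y hy), hc2,
        ← ENNReal.ofReal_mul (Real.exp_nonneg _), ← ENNReal.ofReal_mul (Real.exp_nonneg _),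
        ← Real.exp_add, ← Real.exp_add]
      apply ENNReal.ofReal_le_ofReal
      apply Real.exp_le_exp.2
      rw [← sub_eq_add_neg, ← Finset.sum_sub_distrib, ← Finset.sum_add_distrib]
      apply Finset.sum_le_sum
      intro i _
      nlinarith [sq_nonneg (k i - (x i - y i) / 2)]
    · simp [hy]
  · simp [hx]

theorem var_le_of_exp {Ω : Type*} [MeasurableSpace Ω] (ν : Measure Ω) [IsProbabilityMeasure ν]
    (X : Ω → ℝ) (hX : Measurable X) (v : ℝ)
    (hint : ∀ t, Integrable (fun ω => Real.exp (t * X ω)) ν)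
    (H : ∀ t, (∫⁻ ω, ENNReal.ofReal (Real.exp (t * X ω)) ∂ν) *
      (∫⁻ ω, ENNReal.ofReal (Real.exp (-(t * X ω))) ∂ν) ≤ ENNReal.ofReal (Real.exp (t ^ 2 * v))) :
    variance X ν ≤ v := by
  have hint' : ∀ t, Integrable (fun ω => Real.exp (-(t * X ω))) ν := fun t => by
    simpa using hint (-t)
  have hL2 : MemLp X 2 ν := by
    have : integrableExpSet X ν = univ := by ext t; simpa [integrableExpSet] using hint t
    exact memLp_of_mem_interior_integrableExpSet (by simp [this]) 2
  have hH : ∀ t, (∫ ω, Real.exp (t * X ω) ∂ν) * (∫ ω, Real.exp (-(t * X ω)) ∂ν) ≤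
      Real.exp (t ^ 2 * v) := by
    intro t
    rw [← ENNReal.ofReal_le_ofReal_iff (Real.exp_nonneg _), ENNReal.ofReal_mul
      (integral_nonneg fun _ => Real.exp_nonneg _),
      ofReal_integral_eq_lintegral_ofReal (hint t) (.of_forall fun _ => Real.exp_nonneg _),
      ofReal_integral_eq_lintegral_ofReal (hint' t) (.of_forall fun _ => Real.exp_nonneg _)]
    exact H t
  have hi1 : Integrable X ν := hL2.integrable (by norm_num)
  have hi2 : Integrable (fun ω => X ω ^ 2) ν := hL2.integrable_sq
  have hvar : variance X ν = (∫ ω, X ω ^ 2 ∂ν) - (∫ ω, X ω ∂ν) ^ 2 := variance_eq_sub hL2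
  have key : ∀ t, 1 + t ^ 2 * variance X ν ≤ Real.exp (t ^ 2 * v) := by
    intro t
    refine le_trans ?_ (hH t)
    have i1 := (hint t).mul_prod (hint' t)
    have i2 := (hint' t).mul_prod (hint t)
    have e1 : ∫ p : Ω × Ω, (Real.exp (t * X p.1) * Real.exp (-(t * X p.2)) +
        Real.exp (-(t * X p.1)) * Real.exp (t * X p.2)) ∂(ν.prod ν) =
        2 * ((∫ ω, Real.exp (t * X ω) ∂ν) * (∫ ω, Real.exp (-(t * X ω)) ∂ν)) := by
      rw [integral_add i1 i2, integral_prod_mul (fun ω => Real.exp (t * X ω)) (fun ω => Real.exp (-(t * X ω))),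
        integral_prod_mul (fun ω => Real.exp (-(t * X ω))) (fun ω => Real.exp (t * X ω))]
      ring
    have j1 : Integrable (fun p : Ω × Ω => X p.1 ^ 2) (ν.prod ν) := hi2.comp_fst ν
    have j2 : Integrable (fun p : Ω × Ω => X p.2 ^ 2) (ν.prod ν) := hi2.comp_snd ν
    have j3 : Integrable (fun p : Ω × Ω => X p.1 * X p.2) (ν.prod ν) := hi1.mul_prod hi1
    have j4 : Integrable (fun p : Ω × Ω => X p.1 ^ 2 + X p.2 ^ 2) (ν.prod ν) := j1.add j2
    have j5 : Integrable (fun p : Ω × Ω => X p.1 ^ 2 + X p.2 ^ 2 - 2 * (X p.1 * X p.2))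
      (ν.prod ν) := j4.sub (j3.const_mul 2)
    have e2 : ∫ p : Ω × Ω, (2 + t ^ 2 * (X p.1 ^ 2 + X p.2 ^ 2 - 2 * (X p.1 * X p.2))) ∂(ν.prod ν) =
        2 * (1 + t ^ 2 * variance X ν) := by
      rw [integral_add (integrable_const _) (j5.const_mul _),
        integral_const_mul, integral_sub j4 (j3.const_mul 2), integral_add j1 j2,
        integral_const_mul, integral_prod_mul, integral_fun_fst (fun ω => X ω ^ 2),
        integral_fun_snd (fun ω => X ω ^ 2), hvar]
      simp
      ring
    have : 2 * (1 + t ^ 2 * variance X ν) ≤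
        2 * ((∫ ω, Real.exp (t * X ω) ∂ν) * (∫ ω, Real.exp (-(t * X ω)) ∂ν)) := by
      rw [← e1, ← e2]
      apply integral_mono
        ((integrable_const _).add (j5.const_mul _)) (i1.add i2)
      intro p
      simp only [Pi.add_apply, ← Real.exp_add]
      have := one_add_sq_le_cosh (t * X p.1 - t * X p.2)
      rw [Real.cosh_eq] at this
      have h2 : -(t * X p.1) + t * X p.2 = -(t * X p.1 - t * X p.2) := by ring
      rw [h2, ← sub_eq_add_neg]
      nlinarith
    linarith
  have hd : Filter.Tendsto (fun s : ℝ => s⁻¹ * (Real.exp (s * v) - 1)) (nhdsWithin 0 (Ioi 0)) (nhds v) := by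
    have h1 : HasDerivAt (fun s : ℝ => Real.exp (s * v)) v 0 := by
      have := ((hasDerivAt_id (0 : ℝ)).mul_const v).exp
      simpa using this
    have := h1.tendsto_slope_zero_right
    simpa using this
  refine ge_of_tendsto hd ?_
  filter_upwards [self_mem_nhdsWithin] with s hs
  have hs' : 0 < s := hs
  have := key (Real.sqrt s)
  rw [Real.sq_sqrt hs'.le] at this
  rw [inv_mul_eq_div, le_div_iff₀ hs']
  linarith

theorem fam_lin {n : ℕ} {Ω : Type*} [MeasurableSpace Ω] (P : Measure Ω) (Z : Fin n → Ω → ℝ)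
    (m : Fin n → ℝ) (A : Matrix (Fin n) (Fin n) ℝ)
    (hgauss : IsGaussFam P (fun i ω => Z i ω - m i) (fun i j => A i j)) (l : Fin n → ℝ) :
    P.map (fun ω => ∑ i, l i * (Z i ω - m i)) =
      gaussianReal 0 (∑ i, ∑ j, l i * l j * A i j).toNNReal := by
  have h := hgauss.2 (Finsupp.equivFunOnFinite.symm l)
  have hs : ∀ f : Fin n → ℝ, (∀ i, l i = 0 → f i = 0) →
      ∑ i ∈ (Finsupp.equivFunOnFinite.symm l).support, f i = ∑ i, f i := by
    intro f hf
    apply Finset.sum_subset (Finset.subset_univ _)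
    intro i _ hi
    apply hf
    simpa using hi
  have e1 : (fun ω => ∑ i ∈ (Finsupp.equivFunOnFinite.symm l).support,
      (Finsupp.equivFunOnFinite.symm l) i * (Z i ω - m i)) =
      fun ω => ∑ i, l i * (Z i ω - m i) := by
    ext ω
    exact hs (fun i => l i * (Z i ω - m i)) (fun i hi => by simp [hi])
  have e2 : (∑ i ∈ (Finsupp.equivFunOnFinite.symm l).support,
      ∑ j ∈ (Finsupp.equivFunOnFinite.symm l).support, (Finsupp.equivFunOnFinite.symm l) i *
        (Finsupp.equivFunOnFinite.symm l) j * A i j) = ∑ i, ∑ j, l i * l j * A i j := by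
    have : ∀ i, (∑ j ∈ (Finsupp.equivFunOnFinite.symm l).support, l i * l j * A i j) =
        ∑ j, l i * l j * A i j := fun i => hs _ (fun j hj => by simp [hj])
    simp only [Finsupp.equivFunOnFinite_symm_apply_apply, this]
    exact hs _ (fun i hi => by simp [hi])
  rw [e1, e2] at h
  exact h

open scoped MatrixOrder in
theorem law_eq {n : ℕ} {Ω : Type*} [MeasurableSpace Ω] (P : Measure Ω) [IsProbabilityMeasure P]
    (Z : Fin n → Ω → ℝ) (hZ : ∀ i, Measurable (Z i))
    (m : Fin n → ℝ) (A : Matrix (Fin n) (Fin n) ℝ) (hA : A.PosDef)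
    (hgauss : IsGaussFam P (fun i ω => Z i ω - m i) (fun i j => A i j)) :
    ∃ B : Matrix (Fin n) (Fin n) ℝ, P.map (fun ω i => Z i ω) =
      (Measure.pi fun _ : Fin n => gaussianReal 0 1).map (fun w i => m i + ∑ j, B i j * w j) := by
  refine ⟨CFC.sqrt A, ?_⟩
  have h1 : P.map (fun ω => WithLp.toLp 2 (fun i => Z i ω)) =
      multivariateGaussian (WithLp.toLp 2 m) A := by
    have hm : Measurable (fun ω => WithLp.toLp 2 (fun i => Z i ω)) :=
      (WithLp.measurable_toLp 2 _).comp (measurable_pi_lambda _ hZ)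
    have : IsProbabilityMeasure (P.map (fun ω => WithLp.toLp 2 (fun i => Z i ω))) :=
      Measure.isProbabilityMeasure_map hm.aemeasurable
    apply Measure.ext_of_charFun
    ext t
    rw [charFun_multivariateGaussian hA.posSemidef, charFun_apply, integral_map hm.aemeasurable
      (by fun_prop)]
    have hl := fam_lin P Z m A hgauss t
    have hc := congrArg (fun μ => charFun μ 1) hl
    simp only [charFun_gaussianReal] at hc
    rw [charFun_apply, integral_map (by fun_prop) (by fun_prop)] at hc
    have e : ∀ ω, Complex.exp (((inner ℝ (WithLp.toLp 2 (fun i => Z i ω)) t : ℝ) : ℂ) * Complex.I) =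
        Complex.exp ((inner ℝ (∑ i, t i * (Z i ω - m i)) (1 : ℝ) : ℝ) * Complex.I) *
        Complex.exp ((inner ℝ t (WithLp.toLp 2 m) : ℝ) * Complex.I) := by
      intro ω
      rw [← Complex.exp_add, ← add_mul, ← Complex.ofReal_add]
      congr 3
      simp only [PiLp.inner_apply]
      simp [mul_comm, ← Finset.sum_add_distrib, ← add_mul]
    simp only [e]
    rw [integral_mul_const, hc, ← Complex.exp_add]
    congr 1
    have hq : (∑ i, ∑ j, t i * t j * A i j) = (t : Fin n → ℝ) ⬝ᵥ A.mulVec t := by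
      simp only [dotProduct, Matrix.mulVec, Finset.mul_sum]
      refine Finset.sum_congr rfl fun i _ => Finset.sum_congr rfl fun j _ => by ring
    have hq0 : 0 ≤ (t : Fin n → ℝ) ⬝ᵥ A.mulVec t := by
      simpa using hA.posSemidef.dotProduct_mulVec_nonneg (t : Fin n → ℝ)
    rw [hq, Real.coe_toNNReal _ hq0]
    push_cast
    ring
  have h2 := congrArg (fun μ => Measure.map (WithLp.ofLp (p := 2)) μ) h1
  simp only [multivariateGaussian, ← map_pi_eq_stdGaussian] at h2
  rw [Measure.map_map (by fun_prop) (by fun_prop), Measure.map_map (by fun_prop) (by fun_prop),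
    Measure.map_map (by fun_prop) (by fun_prop)] at h2
  refine h2.trans ?_
  congr 1

theorem stmt18 (n : ℕ) (Ω : Type) (_ : MeasurableSpace Ω) (P : Measure Ω)
    (hP : IsProbabilityMeasure P) (Z : Fin n → Ω → ℝ) (m : Fin n → ℝ)
    (A : Matrix (Fin n) (Fin n) ℝ) (hA : A.PosDef)
    (hgauss : IsGaussFam P (fun i ω => Z i ω - m i) (fun i j => A i j))
    (Sp Sm : Finset (Fin n)) (hdisj : Disjoint Sp Sm) (a b : Fin n → ℝ)
    (E : Set Ω)
    (hE : E = {ω | (∀ u ∈ Sp, a u < Z u ω) ∧ ∀ u ∈ Sm, Z u ω < b u})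
    (hpos : 0 < P E) :
    ∀ l : Fin n → ℝ,
      variance (fun ω => ∑ i, l i * Z i ω) (P[|E]) ≤
        variance (fun ω => ∑ i, l i * Z i ω) P := by
  intro l
  have hZ : ∀ i, Measurable (Z i) := by
    intro i
    have := (hgauss.1 i).add_const (m i)
    simpa using this
  have hZv : Measurable (fun ω i => Z i ω) := measurable_pi_lambda _ hZ
  obtain ⟨B, hB⟩ := law_eq P Z hZ m A hA hgauss
  set Q := Measure.pi fun _ : Fin n => gaussianReal 0 1 with hQ
  set T : (Fin n → ℝ) → (Fin n → ℝ) := fun w i => m i + ∑ j, B i j * w j with hT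
  have hTm : Measurable T := by fun_prop
  set S : Set (Fin n → ℝ) := {z | (∀ u ∈ Sp, a u < z u) ∧ ∀ u ∈ Sm, z u < b u} with hS
  have hSm : MeasurableSet S := by
    have : S = (⋂ u ∈ Sp, {z | a u < z u}) ∩ ⋂ u ∈ Sm, {z | z u < b u} := by
      ext z; simp [hS]
    rw [this]
    refine MeasurableSet.inter ?_ ?_
    · exact Finset.measurableSet_biInter _ fun u _ =>
        measurableSet_lt measurable_const (measurable_pi_apply u)
    · exact Finset.measurableSet_biInter _ fun u _ =>
        measurableSet_lt (measurable_pi_apply u) measurable_const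
  have hES : E = (fun ω i => Z i ω) ⁻¹' S := hE
  have hEm : MeasurableSet E := hES ▸ hZv hSm
  set k : Fin n → ℝ := fun j => ∑ i, l i * B i j with hk
  have hlT : ∀ w, ∑ i, l i * T w i = (∑ i, l i * m i) + ∑ j, k j * w j := by
    intro w
    simp only [hT, hk, mul_add, Finset.sum_add_distrib, Finset.mul_sum, Finset.sum_mul]
    rw [Finset.sum_comm]
    simp only [mul_assoc]
  have hconv : ∀ x ∈ T ⁻¹' S, ∀ y ∈ T ⁻¹' S, (fun i => (x i + y i) / 2) ∈ T ⁻¹' S := by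
    intro x hx y hy
    have e : ∀ u, T (fun i => (x i + y i) / 2) u = (T x u + T y u) / 2 := by
      intro u
      have : ∑ j, B u j * ((x j + y j) / 2) = (∑ j, B u j * x j + ∑ j, B u j * y j) / 2 := by
        rw [← Finset.sum_add_distrib, Finset.sum_div]
        exact Finset.sum_congr rfl fun j _ => by ring
      simp only [hT, this]
      ring
    refine ⟨fun u hu => ?_, fun u hu => ?_⟩
    · have h1 := hx.1 u hu
      have h2 := hy.1 u hu
      rw [e]; linarith
    · have h1 := hx.2 u hu
      have h2 := hy.2 u hu
      rw [e]; linarith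
  have hPE : P E = Q (T ⁻¹' S) := by
    rw [hES, ← Measure.map_apply hZv hSm, hB, Measure.map_apply hTm hSm]
  have hlin : ∀ t : ℝ, ∫⁻ ω in E, ENNReal.ofReal (Real.exp (t * ∑ i, l i * Z i ω)) ∂P =
      ENNReal.ofReal (Real.exp (t * ∑ i, l i * m i)) *
      ∫⁻ w in T ⁻¹' S, ENNReal.ofReal (Real.exp (∑ j, (t * k j) * w j)) ∂Q := by
    intro t
    have hF : Measurable fun z : Fin n → ℝ => ENNReal.ofReal (Real.exp (t * ∑ i, l i * z i)) := by
      fun_prop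
    rw [hES, ← setLIntegral_map hSm hF hZv, hB, setLIntegral_map hSm hF hTm,
      ← lintegral_const_mul _ (by fun_prop)]
    congr 1 with w
    rw [hlT, mul_add, Real.exp_add, ENNReal.ofReal_mul (Real.exp_nonneg _), Finset.mul_sum _ _ t,
      Finset.mul_sum _ (fun j => k j * w j) t]
    simp only [mul_assoc]
  have hvar : variance (fun ω => ∑ i, l i * Z i ω) P = ∑ j, k j ^ 2 := by
    have hlm : Measurable fun z : Fin n → ℝ => ∑ i, l i * z i := by fun_prop
    have e1 : variance (fun ω => ∑ i, l i * Z i ω) P =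
        variance (fun z : Fin n → ℝ => ∑ i, l i * z i) (P.map (fun ω i => Z i ω)) := by
      rw [variance_map hlm.aemeasurable hZv.aemeasurable]
      rfl
    rw [e1, hB, variance_map hlm.aemeasurable hTm.aemeasurable]
    have e2 : (fun z : Fin n → ℝ => ∑ i, l i * z i) ∘ T =
        fun w => (∑ i, l i * m i) + (∑ j, fun w : Fin n → ℝ => k j * w j) w := by
      ext w; simp [hlT]
    rw [e2, variance_const_add (by fun_prop)]
    have := variance_sum_pi (μ := fun _ : Fin n => gaussianReal 0 1) (X := fun j x => k j * x)
      (fun j => (memLp_id_gaussianReal 2).const_mul (k j))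
    rw [hQ, this]
    refine Finset.sum_congr rfl fun j _ => ?_
    rw [variance_const_mul]
    have := variance_id_gaussianReal (μ := 0) (v := 1)
    change k j ^ 2 * variance id (gaussianReal 0 1) = _
    simp [this]
  rw [hvar]
  have hPE0 : P E ≠ 0 := hpos.ne'
  have : IsProbabilityMeasure (P[|E]) := cond_isProbabilityMeasure hPE0
  apply var_le_of_exp _ _ (by fun_prop)
  · intro t
    have hi : Integrable (fun ω => Real.exp (t * ∑ i, l i * Z i ω)) P := by
      have h0 := integrable_exp_mul_gaussianReal (μ := 0)
        (v := (∑ i, ∑ j, l i * l j * A i j).toNNReal) t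
      rw [← fam_lin P Z m A hgauss l, integrable_map_measure (by fun_prop) (by fun_prop)] at h0
      have h1 := h0.mul_const (Real.exp (t * ∑ i, l i * m i))
      refine h1.congr (.of_forall fun ω => ?_)
      simp only [Function.comp, ← Real.exp_add, mul_sub, Finset.sum_sub_distrib]
      congr 1; ring
    exact (hi.restrict (s := E)).smul_measure (ENNReal.inv_ne_top.2 hPE0)
  · intro t
    have hneg : ∀ ω, Real.exp (-(t * ∑ i, l i * Z i ω)) = Real.exp ((-t) * ∑ i, l i * Z i ω) := by
      intro ω; rw [neg_mul]
    simp only [hneg]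
    rw [ProbabilityTheory.cond, lintegral_smul_measure, lintegral_smul_measure, hlin, hlin]
    have hg := gauss_exp n (T ⁻¹' S) (hTm hSm) hconv (fun j => t * k j)
    rw [← hQ, ← hPE] at hg
    have en : ∀ w : Fin n → ℝ, -∑ j, t * k j * w j = ∑ j, (-t) * k j * w j := by
      intro w; simp [Finset.sum_neg_distrib]
    have ek : ∑ j, (t * k j) ^ 2 = t ^ 2 * ∑ j, k j ^ 2 := by
      rw [Finset.mul_sum]; exact Finset.sum_congr rfl fun j _ => by ring
    simp only [en, ek] at hg
    have hcan : ENNReal.ofReal (Real.exp (t * ∑ i, l i * m i)) *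
        ENNReal.ofReal (Real.exp ((-t) * ∑ i, l i * m i)) = 1 := by
      rw [← ENNReal.ofReal_mul (Real.exp_nonneg _), ← Real.exp_add]
      simp
    have hinv : (P E)⁻¹ * P E = 1 := ENNReal.inv_mul_cancel hPE0 (measure_ne_top _ _)
    simp only [smul_eq_mul]
    set I1 := ∫⁻ w in T ⁻¹' S, ENNReal.ofReal (Real.exp (∑ j, (t * k j) * w j)) ∂Q
    set I2 := ∫⁻ w in T ⁻¹' S, ENNReal.ofReal (Real.exp (∑ j, ((-t) * k j) * w j)) ∂Q
    set c1 := ENNReal.ofReal (Real.exp (t * ∑ i, l i * m i))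
    set c2 := ENNReal.ofReal (Real.exp ((-t) * ∑ i, l i * m i))
    set R := ENNReal.ofReal (Real.exp (t ^ 2 * ∑ j, k j ^ 2))
    calc (P E)⁻¹ * (c1 * I1) * ((P E)⁻¹ * (c2 * I2))
        = (P E)⁻¹ ^ 2 * (c1 * c2) * (I1 * I2) := by ring
      _ ≤ (P E)⁻¹ ^ 2 * (c1 * c2) * (R * P E ^ 2) := by gcongr
      _ = ((P E)⁻¹ * P E) ^ 2 * (c1 * c2) * R := by ring
      _ = R := by rw [hinv, hcan]; simp

end
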